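/- For every integer n ≥ 2, the set of finite-index subgroups K of the principal congruence subgroup Γ(n) ≤ SL(2,ℤ) satisfying {tr γ : γ ∈ K} = {tr γ : γ ∈ Γ(n)} is infinite. -/

import Mathlib

open scoped MatrixGroups

/-- The trace set of a subgroup of `SL(2, ℤ)`, as a set of integers. -/
def traceSet (H : Subgroup SL(2, ℤ)) : Set ℤ :=
  {t : ℤ | ∃ γ ∈ H, Matrix.trace (γ : Matrix (Fin 2) (Fin 2) ℤ) = t}

/-- The trace set of a subgroup of `Γ(n)`, as a set of integers. -/
def traceSet' (n : ℕ) (K : Subgroup (CongruenceSubgroup.Gamma n)) : Set ℤ :=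
  {t : ℤ | ∃ γ ∈ K, Matrix.trace (((γ : CongruenceSubgroup.Gamma n) : SL(2, ℤ)) :
    Matrix (Fin 2) (Fin 2) ℤ) = t}

open ModularGroup

namespace FareyHolonomy

/-- The order three element of `SL(2, ℤ)` with `S * rot = T`. -/
def rot : SL(2, ℤ) := ⟨!![0, 1; -1, -1], by simp [Matrix.det_fin_two]⟩

@[simp]
lemma coe_rot : (rot : Matrix (Fin 2) (Fin 2) ℤ) = !![0, 1; -1, -1] := rfl

/-- The polar form of `2 (x² - x y + y²)` on the two rows of a matrix. -/
def rowForm (q : SL(2, ℤ)) : ℤ :=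
  2 * q 0 0 * q 1 0 - q 0 0 * q 1 1 - q 0 1 * q 1 0 + 2 * q 0 1 * q 1 1

/-- Half the sum of the values of `2 (x² - x y + y²)` on the two rows and on their sum. -/
def size (q : SL(2, ℤ)) : ℤ :=
  2 * (q 0 0 ^ 2 - q 0 0 * q 0 1 + q 0 1 ^ 2) + 2 * (q 1 0 ^ 2 - q 1 0 * q 1 1 + q 1 1 ^ 2)
    + rowForm q

section Entries

variable (q : SL(2, ℤ))

lemma S_mul_entries : (S * q) 0 0 = -q 1 0 ∧ (S * q) 0 1 = -q 1 1 ∧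
    (S * q) 1 0 = q 0 0 ∧ (S * q) 1 1 = q 0 1 := by
  simp [Matrix.mul_apply, Fin.sum_univ_two]

lemma rot_mul_entries : (rot * q) 0 0 = q 1 0 ∧ (rot * q) 0 1 = q 1 1 ∧
    (rot * q) 1 0 = -q 0 0 - q 1 0 ∧ (rot * q) 1 1 = -q 0 1 - q 1 1 := by
  simp [Matrix.mul_apply, Fin.sum_univ_two, sub_eq_add_neg]

lemma rowForm_S_mul : rowForm (S * q) = -rowForm q := by
  obtain ⟨h1, h2, h3, h4⟩ := S_mul_entries q
  simp only [rowForm, h1, h2, h3, h4]; ring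

lemma rowForm_neg : rowForm (-q) = rowForm q := by
  simp [rowForm]

lemma rowForm_ne_zero : rowForm q ≠ 0 := by
  have h := q.det_coe
  rw [Matrix.det_fin_two] at h
  intro h0
  have : 2 * (q 0 0 * q 1 0 - q 0 1 * q 1 0 + q 0 1 * q 1 1) = 1 := by
    unfold rowForm at h0; linarith
  omega

lemma rowForm_add_rowForm_rot_mul_nonpos : rowForm q + rowForm (rot * q) ≤ 0 := by
  obtain ⟨h1, h2, h3, h4⟩ := rot_mul_entries q
  simp only [rowForm, h1, h2, h3, h4]
  nlinarith [sq_nonneg (q 1 0 - q 1 1), sq_nonneg (q 1 0), sq_nonneg (q 1 1)]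

lemma size_nonneg : 0 ≤ size q := by
  unfold size rowForm
  nlinarith [sq_nonneg (q 0 0 - q 0 1), sq_nonneg (q 0 0), sq_nonneg (q 0 1),
    sq_nonneg (q 1 0 - q 1 1), sq_nonneg (q 1 0), sq_nonneg (q 1 1),
    sq_nonneg (q 0 0 + q 1 0), sq_nonneg (q 0 1 + q 1 1),
    sq_nonneg (q 0 0 + q 1 0 - q 0 1 - q 1 1)]

lemma size_rot_mul : size (rot * q) = size q := by
  obtain ⟨h1, h2, h3, h4⟩ := rot_mul_entries q
  simp only [size, rowForm, h1, h2, h3, h4]; ring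

lemma size_S_mul : size (S * q) = size q - 2 * rowForm q := by
  obtain ⟨h1, h2, h3, h4⟩ := S_mul_entries q
  simp only [size, rowForm, h1, h2, h3, h4]; ring

lemma toNat_size_S_mul_lt {q : SL(2, ℤ)} (h : 0 < rowForm q) :
    (size (S * q)).toNat < (size q).toNat := by
  have h1 := size_S_mul q
  have h2 := size_nonneg (S * q)
  omega

lemma rot_mul_rot_mul_rot : rot * (rot * (rot * q)) = q := by
  have : rot * rot * rot = 1 := by decide
  rw [← mul_assoc, ← mul_assoc, this, one_mul]

lemma S_mul_S_mul : S * (S * q) = -q := by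
  have : S * S = -1 := by decide
  rw [← mul_assoc, this, neg_one_mul]

end Entries

lemma S_mul_rot : S * rot = T := by decide

variable {G : Type*} [Group G]

/-- The parallel transport from the identity to `q` along the trivalent tree of `SL(2, ℤ)`, whose
vertices are the orbits of left multiplication by `rot` and whose edges are the orbits of left
multiplication by `S`, where the edge leaving `q` carries the label `f q`. The recursion follows
the path from `q` to the identity. -/
def transport (f : SL(2, ℤ) → G) (q : SL(2, ℤ)) : G :=
  if 0 < rowForm q then (f q)⁻¹ * transport f (S * q)
  else if 0 < rowForm (rot * q) then
    (f (rot * q))⁻¹ * transport f (S * (rot * q))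
  else if 0 < rowForm (rot * (rot * q)) then
    (f (rot * (rot * q)))⁻¹ * transport f (S * (rot * (rot * q)))
  else 1
termination_by (size q).toNat
decreasing_by
  · exact toNat_size_S_mul_lt ‹_›
  · rw [← size_rot_mul q]; exact toNat_size_S_mul_lt ‹_›
  · rw [← size_rot_mul q, ← size_rot_mul (rot * q)]; exact toNat_size_S_mul_lt ‹_›

variable (f : SL(2, ℤ) → G)

lemma transport_of_pos {q : SL(2, ℤ)} (h : 0 < rowForm q) :
    transport f q = (f q)⁻¹ * transport f (S * q) := by
  rw [transport, if_pos h]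

lemma transport_one : transport f 1 = 1 := by
  rw [transport, if_neg (by decide), if_neg (by decide), if_neg (by decide)]

lemma transport_rot_mul (q : SL(2, ℤ)) : transport f (rot * q) = transport f q := by
  have h1 := rowForm_add_rowForm_rot_mul_nonpos q
  have h2 := rowForm_add_rowForm_rot_mul_nonpos (rot * q)
  have h3 := rowForm_add_rowForm_rot_mul_nonpos (rot * (rot * q))
  rw [rot_mul_rot_mul_rot] at h3
  rw [transport.eq_1 f (rot * q), transport.eq_1 f q, rot_mul_rot_mul_rot]
  split_ifs <;> first | rfl | omega

lemma transport_neg (hf : ∀ q, f (-q) = f q) (q : SL(2, ℤ)) :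
    transport f (-q) = transport f q := by
  induction h : (size q).toNat using Nat.strong_induction_on generalizing q with
  | _ k ih =>
    have key : ∀ p, size p = size q → 0 < rowForm p →
        transport f (-(S * p)) = transport f (S * p) := fun p hp hpos =>
      ih _ (by rw [← h, ← hp]; exact toNat_size_S_mul_lt hpos) _ rfl
    have h1 := size_rot_mul q
    have h2 := size_rot_mul (rot * q)
    rw [transport.eq_1 f (-q), transport.eq_1 f q]
    simp only [mul_neg, rowForm_neg, hf]
    split_ifs with c1 c2 c3
    · rw [key _ rfl c1]
    · rw [key _ h1 c2]
    · rw [key _ (h2.trans h1) c3]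
    · rfl

lemma transport_S_mul (hneg : ∀ q, f (-q) = f q) (hS : ∀ q, f (S * q) = (f q)⁻¹)
    (q : SL(2, ℤ)) : transport f (S * q) = f q * transport f q := by
  rcases (rowForm_ne_zero q).lt_or_gt with h | h
  · rw [transport_of_pos f (q := S * q) (by rw [rowForm_S_mul]; omega), S_mul_S_mul, hS, inv_inv,
      transport_neg f hneg]
  · rw [transport_of_pos f h, mul_inv_cancel_left]

lemma transport_T_mul (hneg : ∀ q, f (-q) = f q) (hS : ∀ q, f (S * q) = (f q)⁻¹)
    (q : SL(2, ℤ)) : transport f (T * q) = f (rot * q) * transport f q := by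
  rw [← S_mul_rot, mul_assoc, transport_S_mul f hneg hS, transport_rot_mul]

/-- The lower triangular unipotent generator of `SL(2, ℤ)`. -/
def lowerT : SL(2, ℤ) := ⟨!![1, 0; 1, 1], by simp [Matrix.det_fin_two]⟩

@[simp]
lemma coe_lowerT : (lowerT : Matrix (Fin 2) (Fin 2) ℤ) = !![1, 0; 1, 1] := rfl

lemma neg_S_mul_rot_mul_rot : -(S * (rot * rot)) = lowerT := by decide

lemma transport_lowerT_mul (hneg : ∀ q, f (-q) = f q) (hS : ∀ q, f (S * q) = (f q)⁻¹)
    (q : SL(2, ℤ)) : transport f (lowerT * q) = f (rot * (rot * q)) * transport f q := by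
  rw [← neg_S_mul_rot_mul_rot, neg_mul, transport_neg f hneg, mul_assoc, mul_assoc,
    transport_S_mul f hneg hS, transport_rot_mul, transport_rot_mul]

lemma transport_mul_of_forall_mul_eq (hneg : ∀ q, f (-q) = f q)
    (hS : ∀ q, f (S * q) = (f q)⁻¹) {γ : SL(2, ℤ)} (hγ : ∀ q, f (q * γ) = f q)
    (q : SL(2, ℤ)) : transport f (q * γ) = transport f q * transport f γ := by
  have key : ∀ g : SL(2, ℤ), ∀ q,
      transport f (g * q * γ) = transport f (g * q) * transport f γ ↔
        transport f (q * γ) = transport f q * transport f γ := by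
    intro g
    have hg : g ∈ Subgroup.closure {S, T} := by
      rw [SpecialLinearGroup.SL2Z_generators]; trivial
    induction hg using Subgroup.closure_induction with
    | mem x hx =>
      intro q
      rcases hx with rfl | rfl
      · rw [mul_assoc, transport_S_mul f hneg hS, transport_S_mul f hneg hS, hγ, mul_assoc,
          mul_right_inj]
      · rw [mul_assoc, transport_T_mul f hneg hS, transport_T_mul f hneg hS, ← mul_assoc rot, hγ,
          mul_assoc, mul_right_inj]
    | one => simp
    | mul x y _ _ hx hy => intro q; rw [mul_assoc x y q, hx, hy]
    | inv x _ hx => intro q; rw [← hx (x⁻¹ * q), mul_inv_cancel_left]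
  simpa [transport_one] using key q 1

section Label

variable (n : ℕ) (u l : G)

open Classical in
/-- A labelling of `SL(2, ℤ)` by the values `u`, `l` and `1`, depending only on the class modulo
`±Γ(n)`, with value `u` at `rot` and `l` at `rot * rot`. -/
noncomputable def baseLabel (q : SL(2, ℤ)) : G :=
  if (q 0 0 : ZMod n) = 0 ∧ (q 0 1 : ZMod n) * q 1 1 = -1 then u
  else if (q 1 1 : ZMod n) = 0 ∧ (q 0 0 : ZMod n) * q 1 0 = -1 then l
  else 1

/-- The antisymmetrization of `baseLabel` under left multiplication by `S`. -/
noncomputable def label (q : SL(2, ℤ)) : G :=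
  baseLabel n u l q * (baseLabel n u l (S * q))⁻¹

lemma baseLabel_neg (q : SL(2, ℤ)) : baseLabel n u l (-q) = baseLabel n u l q := by
  simp [baseLabel]

lemma label_neg (q : SL(2, ℤ)) : label n u l (-q) = label n u l q := by
  simp [label, baseLabel_neg]

lemma label_S_mul (q : SL(2, ℤ)) : label n u l (S * q) = (label n u l q)⁻¹ := by
  simp [label, S_mul_S_mul, baseLabel_neg]

lemma baseLabel_mul {γ : SL(2, ℤ)} (hγ : γ ∈ CongruenceSubgroup.Gamma n) (q : SL(2, ℤ)) :
    baseLabel n u l (q * γ) = baseLabel n u l q := by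
  obtain ⟨h1, h2, h3, h4⟩ := CongruenceSubgroup.Gamma_mem.1 hγ
  simp [baseLabel, Matrix.mul_apply, Fin.sum_univ_two, h1, h2, h3, h4]

lemma label_mul {γ : SL(2, ℤ)} (hγ : γ ∈ CongruenceSubgroup.Gamma n) (q : SL(2, ℤ)) :
    label n u l (q * γ) = label n u l q := by
  rw [label, label, ← mul_assoc, baseLabel_mul n u l hγ, baseLabel_mul n u l hγ]

/-- The homomorphism on `Γ(n)` given by parallel transport. -/
noncomputable def holonomy : CongruenceSubgroup.Gamma n →* G where
  toFun γ := transport (label n u l) γ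
  map_one' := transport_one _
  map_mul' γ δ := transport_mul_of_forall_mul_eq _ (label_neg n u l) (label_S_mul n u l)
    (label_mul n u l δ.2) γ

lemma holonomy_apply (γ : CongruenceSubgroup.Gamma n) :
    holonomy n u l γ = transport (label n u l) γ := rfl

lemma coe_T_pow (i : ℕ) :
    ((T ^ i : SL(2, ℤ)) : Matrix (Fin 2) (Fin 2) ℤ) = !![1, (i : ℤ); 0, 1] := by
  rw [← zpow_natCast, coe_T_zpow]

lemma coe_lowerT_pow (i : ℕ) :
    ((lowerT ^ i : SL(2, ℤ)) : Matrix (Fin 2) (Fin 2) ℤ) = !![1, 0; (i : ℤ), 1] := by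
  induction i with
  | zero => simp [Matrix.one_fin_two]
  | succ i ih =>
    rw [pow_succ, Matrix.SpecialLinearGroup.coe_mul, ih, coe_lowerT]
    simp

variable {n}

lemma label_rot_mul_T_pow (hn : 2 ≤ n) (i : ℕ) :
    label n u l (rot * T ^ i) = if n ∣ i then u else 1 := by
  have : Fact (1 < n) := ⟨hn⟩
  have h1 : baseLabel n u l (T ^ (i + 1)) = 1 := by
    simp [-Matrix.SpecialLinearGroup.coe_pow, baseLabel, coe_T_pow]
  rw [label, ← mul_assoc, S_mul_rot, ← pow_succ', h1]
  simp [-Matrix.SpecialLinearGroup.coe_pow, baseLabel, coe_T_pow, Matrix.mul_apply, Fin.sum_univ_two,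
    ZMod.natCast_eq_zero_iff, neg_add_eq_sub]

lemma label_rot_mul_rot_mul_lowerT_pow (hn : 2 ≤ n) (i : ℕ) :
    label n u l (rot * (rot * lowerT ^ i)) = if n ∣ i then l else 1 := by
  have : Fact (1 < n) := ⟨hn⟩
  have h1 : baseLabel n u l (lowerT ^ (i + 1)) = 1 := by
    simp [-Matrix.SpecialLinearGroup.coe_pow, baseLabel, coe_lowerT_pow]
  rw [label, ← baseLabel_neg n u l (S * _), ← mul_assoc rot, ← mul_assoc S, ← neg_mul,
    neg_S_mul_rot_mul_rot, ← pow_succ', h1]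
  simp [-Matrix.SpecialLinearGroup.coe_pow, baseLabel, coe_lowerT_pow, Matrix.mul_apply,
    Fin.sum_univ_two, ZMod.natCast_eq_zero_iff]

lemma transport_T_pow (hn : 2 ≤ n) : transport (label n u l) (T ^ n) = u := by
  have key : ∀ i < n, transport (label n u l) (T ^ (i + 1)) = u := by
    intro i hi
    induction i with
    | zero =>
      rw [pow_succ', transport_T_mul _ (label_neg n u l) (label_S_mul n u l),
        label_rot_mul_T_pow u l hn]
      simp [transport_one]
    | succ i ih =>
      rw [pow_succ', transport_T_mul _ (label_neg n u l) (label_S_mul n u l),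
        label_rot_mul_T_pow u l hn, ih (by omega),
        if_neg (Nat.not_dvd_of_pos_of_lt i.succ_pos hi), one_mul]
  simpa [show n - 1 + 1 = n by omega] using key (n - 1) (by omega)

lemma transport_lowerT_pow (hn : 2 ≤ n) : transport (label n u l) (lowerT ^ n) = l := by
  have key : ∀ i < n, transport (label n u l) (lowerT ^ (i + 1)) = l := by
    intro i hi
    induction i with
    | zero =>
      rw [pow_succ', transport_lowerT_mul _ (label_neg n u l) (label_S_mul n u l),
        label_rot_mul_rot_mul_lowerT_pow u l hn]
      simp [transport_one]
    | succ i ih =>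
      rw [pow_succ', transport_lowerT_mul _ (label_neg n u l) (label_S_mul n u l),
        label_rot_mul_rot_mul_lowerT_pow u l hn, ih (by omega),
        if_neg (Nat.not_dvd_of_pos_of_lt i.succ_pos hi), one_mul]
  simpa [show n - 1 + 1 = n by omega] using key (n - 1) (by omega)

end Label

variable (n : ℕ)

/-- The element `T ^ n` of `Γ(n)`. -/
def upperGamma : CongruenceSubgroup.Gamma n :=
  ⟨T ^ n, by simp [-Matrix.SpecialLinearGroup.coe_pow, CongruenceSubgroup.Gamma_mem, coe_T_pow]⟩

/-- The element `lowerT ^ n` of `Γ(n)`. -/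
def lowerGamma : CongruenceSubgroup.Gamma n :=
  ⟨lowerT ^ n, by simp [-Matrix.SpecialLinearGroup.coe_pow, CongruenceSubgroup.Gamma_mem,
    coe_lowerT_pow]⟩

lemma coe_lowerGamma_zpow (k : ℤ) :
    (((lowerGamma n ^ k : CongruenceSubgroup.Gamma n) : SL(2, ℤ)) : Matrix (Fin 2) (Fin 2) ℤ) =
      !![1, 0; n * k, 1] := by
  obtain ⟨k, rfl | rfl⟩ := k.eq_nat_or_neg
  · simp [-Matrix.SpecialLinearGroup.coe_pow, lowerGamma, ← pow_mul, coe_lowerT_pow]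
  · simp [-Matrix.SpecialLinearGroup.coe_pow, lowerGamma, ← pow_mul, coe_lowerT_pow,
      Matrix.SpecialLinearGroup.coe_inv, Matrix.adjugate_fin_two]

lemma trace_upperGamma_mul_lowerGamma_zpow (k : ℤ) :
    Matrix.trace (((upperGamma n * lowerGamma n ^ k : CongruenceSubgroup.Gamma n) : SL(2, ℤ)) :
      Matrix (Fin 2) (Fin 2) ℤ) = 2 + n ^ 2 * k := by
  rw [Subgroup.coe_mul, Matrix.SpecialLinearGroup.coe_mul, coe_lowerGamma_zpow]
  simp [-Matrix.SpecialLinearGroup.coe_pow, upperGamma, coe_T_pow, Matrix.trace_fin_two]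
  ring

lemma exists_trace_eq {γ : SL(2, ℤ)} (hγ : γ ∈ CongruenceSubgroup.Gamma n) :
    ∃ k : ℤ, Matrix.trace (γ : Matrix (Fin 2) (Fin 2) ℤ) = 2 + n ^ 2 * k := by
  obtain ⟨h1, h2, h3, h4⟩ := CongruenceSubgroup.Gamma_mem.1 hγ
  have h1' : ((γ 0 0 - 1 : ℤ) : ZMod n) = 0 := by simp [h1]
  have h4' : ((γ 1 1 - 1 : ℤ) : ZMod n) = 0 := by simp [h4]
  obtain ⟨a, ha⟩ := (ZMod.intCast_zmod_eq_zero_iff_dvd _ n).1 h1'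
  obtain ⟨b, hb⟩ := (ZMod.intCast_zmod_eq_zero_iff_dvd _ n).1 h2
  obtain ⟨c, hc⟩ := (ZMod.intCast_zmod_eq_zero_iff_dvd _ n).1 h3
  obtain ⟨d, hd⟩ := (ZMod.intCast_zmod_eq_zero_iff_dvd _ n).1 h4'
  have hdet := γ.det_coe
  rw [Matrix.det_fin_two, hb, hc, eq_add_of_sub_eq ha, eq_add_of_sub_eq hd] at hdet
  refine ⟨b * c - a * d, ?_⟩
  rw [Matrix.trace_fin_two, eq_add_of_sub_eq ha, eq_add_of_sub_eq hd]
  linear_combination hdet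

/-- The preimage of a subgroup of order two under the dihedral holonomy representation. -/
noncomputable def reflectionStabilizer (m : ℕ) : Subgroup (CongruenceSubgroup.Gamma n) :=
  (Subgroup.zpowers (DihedralGroup.sr 0)).comap
    (holonomy n (DihedralGroup.sr 0 : DihedralGroup (2 * m + 1)) (DihedralGroup.r 1))

variable {n}

lemma holonomy_upperGamma (hn : 2 ≤ n) (u l : G) : holonomy n u l (upperGamma n) = u :=
  transport_T_pow u l hn

lemma holonomy_lowerGamma (hn : 2 ≤ n) (u l : G) : holonomy n u l (lowerGamma n) = l :=
  transport_lowerT_pow u l hn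

lemma holonomy_dihedral_surjective (hn : 2 ≤ n) (N : ℕ) [NeZero N] : Function.Surjective
    (holonomy n (DihedralGroup.sr 0 : DihedralGroup N) (DihedralGroup.r 1)) := by
  rintro (i | i)
  · refine ⟨lowerGamma n ^ i.val, ?_⟩
    rw [map_pow, holonomy_lowerGamma hn]
    simp
  · refine ⟨upperGamma n * lowerGamma n ^ i.val, ?_⟩
    rw [map_mul, map_pow, holonomy_lowerGamma hn, holonomy_upperGamma hn]
    simp

lemma index_reflectionStabilizer (hn : 2 ≤ n) (m : ℕ) :
    (reflectionStabilizer n m).index = 2 * m + 1 := by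
  rw [reflectionStabilizer,
    Subgroup.index_comap_of_surjective _ (holonomy_dihedral_surjective hn _)]
  have h := Subgroup.card_mul_index
    (Subgroup.zpowers (DihedralGroup.sr 0 : DihedralGroup (2 * m + 1)))
  rw [Nat.card_zpowers, DihedralGroup.orderOf_sr, DihedralGroup.nat_card] at h
  omega

lemma traceSet'_reflectionStabilizer (hn : 2 ≤ n) (m : ℕ) :
    traceSet' n (reflectionStabilizer n m) = traceSet (CongruenceSubgroup.Gamma n) := by
  apply Set.Subset.antisymm
  · rintro _ ⟨γ, -, rfl⟩
    exact ⟨γ, γ.2, rfl⟩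
  · rintro _ ⟨γ, hγ, rfl⟩
    obtain ⟨k, hk⟩ := exists_trace_eq n hγ
    set g := lowerGamma n ^ (k * m) with hg
    refine ⟨g⁻¹ * (upperGamma n * lowerGamma n ^ k) * g, ?_, ?_⟩
    · have h : ((k * m + k + k * m : ℤ) : ZMod (2 * m + 1)) = 0 := by
        have : ((2 * m + 1 : ℕ) : ZMod (2 * m + 1)) = 0 := ZMod.natCast_self _
        push_cast at this ⊢
        linear_combination (k : ZMod (2 * m + 1)) * this
      rw [reflectionStabilizer, Subgroup.mem_comap, Subgroup.mem_zpowers_iff]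
      refine ⟨1, ?_⟩
      simp only [hg, map_mul, map_inv, map_zpow, holonomy_lowerGamma hn, holonomy_upperGamma hn]
      push_cast at h
      simp [DihedralGroup.r_zpow]
      linear_combination -h
    · rw [hk, ← trace_upperGamma_mul_lowerGamma_zpow]
      simp only [Subgroup.coe_mul, Subgroup.coe_inv, Matrix.SpecialLinearGroup.coe_mul]
      rw [Matrix.trace_mul_comm, ← Matrix.mul_assoc,
        ← Matrix.SpecialLinearGroup.coe_mul (g : SL(2, ℤ)),
        mul_inv_cancel, Matrix.SpecialLinearGroup.coe_one, one_mul]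

end FareyHolonomy

/-- For every `n ≥ 2`, there are infinitely many finite-index subgroups of the principal
congruence subgroup `Γ(n)` with the same trace set as `Γ(n)`. -/
theorem infinite_finite_index_subgroups_traceSet_Gamma (n : ℕ) (hn : 2 ≤ n) :
    {K : Subgroup (CongruenceSubgroup.Gamma n) | K.FiniteIndex ∧
      traceSet' n K = traceSet (CongruenceSubgroup.Gamma n)}.Infinite := by
  refine Set.infinite_of_injective_forall_mem (f := FareyHolonomy.reflectionStabilizer n) ?_ ?_
  · intro m m' h
    have := congrArg Subgroup.index h
    simpa only [FareyHolonomy.index_reflectionStabilizer hn, Nat.add_right_cancel_iff,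
      Nat.mul_right_inj (two_ne_zero)] using this
  · intro m
    refine ⟨⟨?_⟩, FareyHolonomy.traceSet'_reflectionStabilizer hn m⟩
    rw [FareyHolonomy.index_reflectionStabilizer hn]
    omega
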